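/- Let T ⊂ S³ be the circle subgroup {a + b·i : a, b ∈ ℝ, a² + b² = 1}. Every closed subgroup H of S³ is either finite or contains a conjugate of T: if H is a closed subgroup of S³ that is not finite, then there exists g ∈ S³ with g t g⁻¹ ∈ H for every t ∈ T. (Hence for any action of SU(2), stabilizers of points are either finite or of rank 1, i.e., contain a maximal torus.) -/

import Mathlib

noncomputable section

/-- `S³`, the group of unit quaternions. -/
abbrev S3 : Type := Metric.sphere (0 : Quaternion ℝ) 1

open Filter Topology Quaternion

/-- The quaternion unit `i`. -/
def unitI : ℍ[ℝ] := ⟨0, 1, 0, 0⟩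

@[simp] theorem unitI_re : unitI.re = 0 := rfl
@[simp] theorem unitI_imI : unitI.imI = 1 := rfl
@[simp] theorem unitI_imJ : unitI.imJ = 0 := rfl
@[simp] theorem unitI_imK : unitI.imK = 0 := rfl

/-- The quaternion unit `j`. -/
def unitJ : ℍ[ℝ] := ⟨0, 0, 1, 0⟩

@[simp] theorem unitJ_re : unitJ.re = 0 := rfl
@[simp] theorem unitJ_imI : unitJ.imI = 0 := rfl
@[simp] theorem unitJ_imJ : unitJ.imJ = 1 := rfl
@[simp] theorem unitJ_imK : unitJ.imK = 0 := rfl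

theorem unitI_mul_unitI : unitI * unitI = -1 := by ext <;> simp

/-- De Moivre's formula for a quaternionic square root `u` of `-1`. -/
theorem quaternion_deMoivre {u : ℍ[ℝ]} (hu : u * u = -1) (θ : ℝ) (k : ℕ) :
    ((Real.cos θ : ℍ[ℝ]) + Real.sin θ • u) ^ k =
      (Real.cos (k * θ) : ℍ[ℝ]) + Real.sin (k * θ) • u := by
  induction k with
  | zero => simp
  | succ k ih =>
    rw [pow_succ, ih]
    push_cast
    rw [add_mul (k : ℝ) 1 θ, one_mul, Real.cos_add, Real.sin_add]
    simp only [add_mul, mul_add, smul_mul_smul_comm, hu, coe_mul_eq_smul, mul_coe_eq_smul]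
    ext <;> simp <;> ring

theorem im_mul_im_eq_neg_norm_sq (q : ℍ[ℝ]) : q.im * q.im = ((-(‖q.im‖ ^ 2) : ℝ) : ℍ[ℝ]) := by
  rw [sq, ← normSq_eq_norm_mul_self, normSq_def']
  ext <;> simp only [re_mul, imI_mul, imJ_mul, imK_mul, re_im, imI_im, imJ_im, imK_im, re_coe,
    imI_coe, imJ_coe, imK_coe] <;> ring

theorem norm_im_sq_of_norm_one {q : ℍ[ℝ]} (hq : ‖q‖ = 1) : ‖q.im‖ ^ 2 = 1 - q.re ^ 2 := by
  have h : normSq q = 1 := by rw [normSq_eq_norm_mul_self, hq, one_mul]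
  rw [sq, ← normSq_eq_norm_mul_self, normSq_def']
  rw [normSq_def'] at h
  simp
  linarith

/-- Every quaternionic square root of `-1` is conjugate to `i` by a unit quaternion. -/
theorem exists_conj_i {u : ℍ[ℝ]} (hu : u * u = -1) :
    ∃ g : S3, u * (g : ℍ[ℝ]) = g * unitI := by
  obtain ⟨q, hq0, hq⟩ : ∃ q : ℍ[ℝ], q ≠ 0 ∧ u * q = q * unitI := by
    by_cases h : 1 - u * unitI = 0
    · refine ⟨unitJ, fun h => by simpa using congrArg QuaternionAlgebra.imJ h, ?_⟩
      have hu' : u = -unitI := by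
        have := congrArg (· * unitI) h
        simp only [sub_mul, mul_assoc, unitI_mul_unitI, zero_mul, one_mul, mul_neg, mul_one] at this
        rw [sub_neg_eq_add] at this
        exact (neg_eq_of_add_eq_zero_right this).symm
      rw [hu']
      ext <;> simp
    · refine ⟨_, h, ?_⟩
      rw [mul_sub, sub_mul, ← mul_assoc, hu, mul_assoc, unitI_mul_unitI]
      simp [add_comm]
  refine ⟨⟨(‖q‖⁻¹ : ℝ) • q, ?_⟩, ?_⟩
  · simp [norm_smul, hq0]
  · simp [hq]

/-- The identity is not isolated in an infinite closed subgroup of `S³`. -/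
theorem nhdsNE_one_neBot_of_infinite (H : Subgroup S3) (hclosed : IsClosed (H : Set S3))
    (hinf : ¬ (H : Set S3).Finite) : (𝓝[≠] (1 : H)).NeBot := by
  by_contra h
  rw [not_neBot, ← isOpen_singleton_iff_punctured_nhds] at h
  have := discreteTopology_of_isOpen_singleton_one h
  have : CompactSpace H := isCompact_iff_compactSpace.mp hclosed.isCompact
  exact hinf (Set.finite_coe_iff.mp (finite_of_compact_of_discrete (X := H)))

/-- An infinite closed subgroup of `S³` contains a one-parameter subgroup. -/
theorem exists_oneParameter_mem (H : Subgroup S3) (hclosed : IsClosed (H : Set S3))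
    (hinf : ¬ (H : Set S3).Finite) :
    ∃ u : ℍ[ℝ], u * u = -1 ∧ ∀ s : ℝ, 0 ≤ s → ∃ h ∈ H,
      (h : ℍ[ℝ]) = (Real.cos s : ℍ[ℝ]) + Real.sin s • u := by
  have := nhdsNE_one_neBot_of_infinite H hclosed hinf
  set F := Ultrafilter.of (𝓝[≠] (1 : H))
  have hF : (F : Filter H) ≤ 𝓝[≠] 1 := Ultrafilter.of_le _
  have hF1 : Tendsto (fun h : H => ((h : S3) : ℍ[ℝ])) F (𝓝 1) := by
    have : Continuous (fun h : H => ((h : S3) : ℍ[ℝ])) := by fun_prop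
    exact (this.tendsto 1).mono_left (hF.trans nhdsWithin_le_nhds)
  have hre : Tendsto (fun h : H => ((h : S3) : ℍ[ℝ]).re) F (𝓝 1) :=
    (continuous_re.tendsto 1).comp hF1
  have hne : ∀ᶠ h : H in (F : Filter H), h ≠ 1 := hF self_mem_nhdsWithin
  let θ : H → ℝ := fun h => Real.arccos ((h : S3) : ℍ[ℝ]).re
  let v : H → ℍ[ℝ] := fun h => ‖((h : S3) : ℍ[ℝ]).im‖⁻¹ • ((h : S3) : ℍ[ℝ]).im
  have hθ : Tendsto θ F (𝓝 0) := by
    simpa [θ, Function.comp_def] using (Real.continuous_arccos.tendsto 1).comp hre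
  have hnorm (h : H) : ‖((h : S3) : ℍ[ℝ])‖ = 1 := by simp
  have him : ∀ᶠ h : H in (F : Filter H), 0 < ‖((h : S3) : ℍ[ℝ]).im‖ := by
    filter_upwards [hne, hre.eventually (lt_mem_nhds zero_lt_one)] with h h1 h2
    rw [norm_pos_iff]
    intro h0
    have h3 := norm_im_sq_of_norm_one (hnorm h)
    rw [h0] at h3
    have h4 : ((h : S3) : ℍ[ℝ]).re = 1 := by
      simp at h3
      nlinarith
    apply h1
    apply Subtype.ext
    apply Subtype.ext
    have h5 := re_add_im ((h : S3) : ℍ[ℝ])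
    rw [h0, h4] at h5
    simpa using h5.symm
  have hv : ∀ᶠ h : H in (F : Filter H), v h * v h = -1 := by
    filter_upwards [him] with h h1
    simp only [v, smul_mul_smul_comm, im_mul_im_eq_neg_norm_sq]
    rw [smul_coe, ← coe_one, ← coe_neg]
    congr 1
    field_simp
  have hpolar : ∀ᶠ h : H in (F : Filter H),
      ((h : S3) : ℍ[ℝ]) = (Real.cos (θ h) : ℍ[ℝ]) + Real.sin (θ h) • v h := by
    filter_upwards [him] with h h1
    have h2 := norm_im_sq_of_norm_one (hnorm h)
    have h3 : -1 ≤ ((h : S3) : ℍ[ℝ]).re := by nlinarith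
    have h4 : ((h : S3) : ℍ[ℝ]).re ≤ 1 := by nlinarith
    simp only [θ, v]
    rw [Real.cos_arccos h3 h4, Real.sin_arccos, ← h2, Real.sqrt_sq h1.le, smul_smul,
      mul_inv_cancel₀ h1.ne', one_smul, re_add_im]
  have hθpos : ∀ᶠ h : H in (F : Filter H), 0 < θ h := by
    filter_upwards [him] with h h1
    have h2 := norm_im_sq_of_norm_one (hnorm h)
    exact Real.arccos_pos.mpr (by nlinarith)
  obtain ⟨u, -, hu⟩ := (isCompact_closedBall (0 : ℍ[ℝ]) 1).ultrafilter_le_nhds (F.map v) (by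
    rw [le_principal_iff]
    refine Eventually.of_forall (f := (F : Filter H)) fun h => ?_
    rw [mem_closedBall_zero_iff, norm_smul, norm_inv, norm_norm]
    exact inv_mul_le_one)
  have hu : Tendsto v F (𝓝 u) := hu
  refine ⟨u, tendsto_nhds_unique (hu.mul hu) (tendsto_const_nhds.congr' ?_), fun s hs => ?_⟩
  · filter_upwards [hv] with h h1 using h1.symm
  have hk : Tendsto (fun h => (⌊s / θ h⌋₊ : ℝ) * θ h) F (𝓝 s) := by
    refine tendsto_of_tendsto_of_tendsto_of_le_of_le' (g := fun h => s - θ h)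
      (by simpa using hθ.const_sub s) tendsto_const_nhds ?_ ?_
    · filter_upwards [hθpos] with h h1
      have := Nat.lt_floor_add_one (s / θ h)
      rw [div_lt_iff₀ h1] at this
      linarith
    · filter_upwards [hθpos] with h h1
      rw [← le_div_iff₀ h1]
      exact Nat.floor_le (by positivity)
  have hlim : Tendsto (fun h : H => (((h : S3) ^ ⌊s / θ h⌋₊ : S3) : ℍ[ℝ])) F
      (𝓝 ((Real.cos s : ℍ[ℝ]) + Real.sin s • u)) := by
    have h1 := ((continuous_coe.tendsto _).comp ((Real.continuous_cos.tendsto s).comp hk)).add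
      (((Real.continuous_sin.tendsto s).comp hk).smul hu)
    refine h1.congr' ?_
    filter_upwards [hv, hpolar] with h h2 h3
    rw [Metric.unitSphere.coe_pow, h3, quaternion_deMoivre h2]
    rfl
  have hclosed' : IsClosed ((↑) '' (H : Set S3) : Set ℍ[ℝ]) :=
    (hclosed.isCompact.image continuous_subtype_val).isClosed
  exact hclosed'.mem_of_tendsto hlim
    (Eventually.of_forall fun h => ⟨_, H.pow_mem h.2 _, rfl⟩)

/-- Every closed subgroup of `S³` which is not finite contains a conjugate of the
circle subgroup `T = {a + b·i : a² + b² = 1}`. -/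
theorem stmt19 (H : Subgroup S3) (hclosed : IsClosed (H : Set S3))
    (hinf : ¬ (H : Set S3).Finite) :
    ∃ g : S3, ∀ t : S3, (t : Quaternion ℝ).imJ = 0 → (t : Quaternion ℝ).imK = 0 →
      g * t * g⁻¹ ∈ H := by
  obtain ⟨u, hu, hmem⟩ := exists_oneParameter_mem H hclosed hinf
  obtain ⟨g, hg⟩ := exists_conj_i hu
  refine ⟨g, fun t hJ hK => ?_⟩
  set z : ℂ := ⟨(t : ℍ[ℝ]).re, (t : ℍ[ℝ]).imI⟩ with hz
  have hz1 : ‖z‖ = 1 := by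
    have h : normSq (t : ℍ[ℝ]) = 1 := by rw [normSq_eq_norm_mul_self]; simp
    rw [normSq_def', hJ, hK] at h
    rw [Complex.norm_def, Complex.normSq_mk, Real.sqrt_eq_one]
    linarith
  have hz0 : z ≠ 0 := by
    rw [← norm_pos_iff, hz1]
    exact one_pos
  obtain ⟨h, hH, hh⟩ := hmem (z.arg + 2 * Real.pi)
    (by linarith [Complex.neg_pi_lt_arg z, Real.pi_pos])
  rw [Real.cos_add_two_pi, Real.sin_add_two_pi, Complex.cos_arg hz0, Complex.sin_arg, hz1,
    div_one, div_one] at hh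
  have ht : (t : ℍ[ℝ]) = ((z.re : ℝ) : ℍ[ℝ]) + z.im • unitI := by
    ext <;> simp [hz, hJ, hK]
  have hgt : g * t = h * g := by
    apply Subtype.ext
    rw [Metric.unitSphere.coe_mul, Metric.unitSphere.coe_mul, hh, ht, mul_add, add_mul, smul_mul_assoc,
      mul_smul_comm, hg, coe_commutes]
  rwa [hgt, mul_inv_cancel_right]
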